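/- Let Γ ⊂ ℤ² be a weakly almost periodic Meyer set with uniform density D(Γ) > 0, and let r ≥ 3 satisfy r² = 8/(π·D(Γ)). Then there exists u₀ ∈ B(0,r) ∩ (ℤ² \ {0}) with ρ_Γ(u₀) ≥ 1/(π(r+1)²) ≥ D(Γ)/16. -/

import Mathlib

open Filter MeasureTheory Metric Pointwise

variable {E : Type*} [NormedAddCommGroup E] [MeasureSpace E]

/-- The uniform `R`-density of a set. -/
noncomputable def densR (Γ : Set E) (R : ℝ) : ℝ :=
  ⨆ x : E, ((Γ ∩ ball x R).ncard : ℝ) / (volume (ball x R)).toReal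

/-- The uniform upper density of a set. -/
noncomputable def upDens (Γ : Set E) : ℝ := limsup (densR Γ) atTop

/-- Uniformly discrete: balls of radius `r` contain at most one point. -/
def UnifDisc (Γ : Set E) : Prop := ∃ r > 0, ∀ x : E, (Γ ∩ closedBall x r).Subsingleton

/-- Relatively dense: balls of radius `R` contain at least one point. -/
def RelDense (Γ : Set E) : Prop := ∃ R > 0, ∀ x : E, (Γ ∩ closedBall x R).Nonempty

def Delone (Γ : Set E) : Prop := UnifDisc Γ ∧ RelDense Γ

def Meyer (Γ : Set E) : Prop := Delone Γ ∧ Delone (Γ - Γ)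

/-- Frequency of the difference `v` in `Γ`. -/
noncomputable def freq (Γ : Set E) (v : E) : ℝ :=
  upDens {x ∈ Γ | x + v ∈ Γ} / upDens Γ

/-- Weakly almost periodic set. -/
def WAP (Γ : Set E) : Prop :=
  Delone Γ ∧ ∀ ε > 0, ∃ R > 0, ∀ x y : E, ∃ v : E,
    ((symmDiff (Γ ∩ ball x R) ((fun z => z - v) '' (Γ ∩ ball y R))).ncard : ℝ)
      ≤ ε * (volume (ball (0 : E) R)).toReal


/-- Points with integer coordinates. -/
def IsIntPt (x : EuclideanSpace ℝ (Fin 2)) : Prop := ∀ i : Fin 2, ∃ m : ℤ, x i = (m : ℝ)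

/-- Half-open unit square centered at `p`. -/
def cube (p : EuclideanSpace ℝ (Fin 2)) : Set (EuclideanSpace ℝ (Fin 2)) :=
  {x | ∀ i, x i ∈ Set.Ico (p i - 1/2) (p i + 1/2)}

lemma cube_eq (p : (EuclideanSpace ℝ (Fin 2))) : cube p = (MeasurableEquiv.toLp 2 (Fin 2 → ℝ)).symm ⁻¹'
    (Set.pi Set.univ fun i => Set.Ico (p i - 1/2) (p i + 1/2)) := by
  ext x
  simp [cube]

lemma cube_meas (p : (EuclideanSpace ℝ (Fin 2))) : MeasurableSet (cube p) := by
  rw [cube_eq]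
  exact (MeasurableEquiv.measurable _) (MeasurableSet.univ_pi fun i => measurableSet_Ico)

lemma cube_vol (p : (EuclideanSpace ℝ (Fin 2))) : volume (cube p) = 1 := by
  rw [cube_eq, (EuclideanSpace.volume_preserving_symm_measurableEquiv_toLp (Fin 2)).measure_preimage
    (MeasurableSet.univ_pi fun i => measurableSet_Ico).nullMeasurableSet, Real.volume_pi_Ico]
  norm_num

lemma cube_disj {p q : (EuclideanSpace ℝ (Fin 2))} (hp : IsIntPt p) (hq : IsIntPt q) (hne : p ≠ q) :
    Disjoint (cube p) (cube q) := by
  rw [Set.disjoint_left]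
  intro x hx hy
  apply hne
  ext i
  obtain ⟨m, hm⟩ := hp i
  obtain ⟨n, hn⟩ := hq i
  have h1 := hx i
  have h2 := hy i
  rw [hm] at h1 ⊢
  rw [hn] at h2 ⊢
  obtain ⟨a, b⟩ := h1
  obtain ⟨c, d⟩ := h2
  have e1 : (m : ℝ) < n + 1 := by linarith
  have e2 : (n : ℝ) < m + 1 := by linarith
  have e1' : m < n + 1 := by exact_mod_cast e1
  have e2' : n < m + 1 := by exact_mod_cast e2
  have : m = n := by omega
  rw [this]

lemma cube_sub {p x : (EuclideanSpace ℝ (Fin 2))} {R : ℝ} (hp : p ∈ ball x R) : cube p ⊆ ball x (R + 1) := by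
  intro z hz
  have h1 : dist z p ≤ 1 := by
    rw [EuclideanSpace.dist_eq, Real.sqrt_le_one]
    simp only [Fin.sum_univ_two, Real.dist_eq, sq_abs]
    obtain ⟨a, b⟩ := hz 0
    obtain ⟨c, d⟩ := hz 1
    nlinarith
  rw [mem_ball] at *
  linarith [dist_triangle z p x]

lemma ball_vol (x : (EuclideanSpace ℝ (Fin 2))) {R : ℝ} (hR : 0 ≤ R) : volume.real (ball x R) = Real.pi * R ^ 2 := by
  rw [Measure.real, EuclideanSpace.volume_ball_fin_two]
  simp [hR, Real.pi_pos.le]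
  ring

lemma card_int_le (F : Finset (EuclideanSpace ℝ (Fin 2))) (x : (EuclideanSpace ℝ (Fin 2))) {R : ℝ} (hR : 0 ≤ R) (hF : ∀ p ∈ F, IsIntPt p)
    (hB : ∀ p ∈ F, p ∈ ball x R) : (F.card : ℝ) ≤ Real.pi * (R + 1) ^ 2 := by
  rw [← ball_vol x (by linarith : 0 ≤ R + 1)]
  have h := measureReal_biUnion_finset (μ := volume) (s := F) (f := cube)
    (fun p hp q hq hne => cube_disj (hF p hp) (hF q hq) hne) (fun p _ => cube_meas p)
    (fun p _ => by rw [cube_vol]; simp)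
  have h2 : volume.real (⋃ b ∈ F, cube b) ≤ volume.real (ball x (R+1)) := by
    apply measureReal_mono
    · exact Set.iUnion₂_subset fun p hp => cube_sub (hB p hp)
    · exact measure_ball_lt_top.ne
  rw [h] at h2
  simpa [Measure.real, cube_vol] using h2

lemma int_finite (S : Set (EuclideanSpace ℝ (Fin 2))) (hS : ∀ p ∈ S, IsIntPt p) (x : (EuclideanSpace ℝ (Fin 2))) (R : ℝ) :
    (S ∩ ball x R).Finite := by
  by_contra hinf
  have hR : 0 ≤ R := by
    by_contra h
    apply hinf
    rw [ball_eq_empty.2 (by linarith)]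
    simp
  obtain ⟨n, hn⟩ := exists_nat_gt (Real.pi * (R + 1) ^ 2)
  obtain ⟨t, ht, hc⟩ := Set.Infinite.exists_subset_card_eq hinf n
  have := card_int_le t x hR (fun p hp => hS p (ht hp).1) (fun p hp => (ht hp).2)
  rw [hc] at this
  linarith

lemma ncard_int_le (S : Set (EuclideanSpace ℝ (Fin 2))) (hS : ∀ p ∈ S, IsIntPt p) (x : (EuclideanSpace ℝ (Fin 2))) {R : ℝ} (hR : 0 ≤ R) :
    ((S ∩ ball x R).ncard : ℝ) ≤ Real.pi * (R + 1) ^ 2 := by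
  rw [Set.ncard_eq_toFinset_card _ (int_finite S hS x R)]
  apply card_int_le _ x hR
  · intro p hp
    exact hS p ((Set.Finite.mem_toFinset _).1 hp).1
  · intro p hp
    exact ((Set.Finite.mem_toFinset _).1 hp).2

lemma quot_le (S : Set (EuclideanSpace ℝ (Fin 2))) (hS : ∀ p ∈ S, IsIntPt p) (x : (EuclideanSpace ℝ (Fin 2))) {R : ℝ} (hR : 1 ≤ R) :
    ((S ∩ ball x R).ncard : ℝ) / (volume (ball x R)).toReal ≤ 4 := by
  have h := ncard_int_le S hS x (by linarith : 0 ≤ R)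
  have hv := ball_vol x (by linarith : 0 ≤ R)
  rw [Measure.real] at hv
  rw [hv, div_le_iff₀ (by positivity)]
  have hpi := Real.pi_pos
  have : (R + 1)^2 ≤ 4 * R^2 := by nlinarith
  nlinarith

lemma densR_le (S : Set (EuclideanSpace ℝ (Fin 2))) (hS : ∀ p ∈ S, IsIntPt p) {R : ℝ} (hR : 1 ≤ R) : densR S R ≤ 4 :=
  ciSup_le fun x => quot_le S hS x hR

lemma densR_nonneg (S : Set (EuclideanSpace ℝ (Fin 2))) (R : ℝ) : 0 ≤ densR S R :=
  Real.iSup_nonneg fun x => by positivity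

lemma le_densR (S : Set (EuclideanSpace ℝ (Fin 2))) (hS : ∀ p ∈ S, IsIntPt p) (x : (EuclideanSpace ℝ (Fin 2))) {R : ℝ} (hR : 1 ≤ R) :
    ((S ∩ ball x R).ncard : ℝ) ≤ densR S R * (Real.pi * R ^ 2) := by
  have hv := ball_vol x (by linarith : 0 ≤ R)
  rw [Measure.real] at hv
  rw [← div_le_iff₀ (by positivity), ← hv]
  exact le_ciSup (f := fun x : (EuclideanSpace ℝ (Fin 2)) => ((S ∩ ball x R).ncard : ℝ) / (volume (ball x R)).toReal)
    ⟨4, by rintro _ ⟨y, rfl⟩; exact quot_le S hS y hR⟩ x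

lemma densR_bdd (S : Set (EuclideanSpace ℝ (Fin 2))) (hS : ∀ p ∈ S, IsIntPt p) :
    IsBoundedUnder (· ≤ ·) atTop (densR S) :=
  ⟨4, by
    rw [eventually_map]
    filter_upwards [eventually_ge_atTop 1] with R hR using densR_le S hS hR⟩

lemma densR_cobdd (S : Set (EuclideanSpace ℝ (Fin 2))) : IsCoboundedUnder (· ≤ ·) atTop (densR S) :=
  IsBoundedUnder.isCoboundedUnder_le ⟨0, by
    rw [eventually_map]
    exact Eventually.of_forall fun R => densR_nonneg S R⟩

open Classical in
/-- Second-moment inequality. -/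
lemma second_moment (F : Finset (EuclideanSpace ℝ (Fin 2))) (y : (EuclideanSpace ℝ (Fin 2))) {R s : ℝ} (hR : 0 ≤ R) (hs : 0 ≤ s)
    (hB : ∀ p ∈ F, p ∈ ball y R) :
    4 * ((F.card : ℝ) * (Real.pi * s ^ 2)) ≤
      (((F ×ˢ F).filter fun q => dist q.1 q.2 < 2 * s).card : ℝ) * (Real.pi * s ^ 2)
        + 4 * (Real.pi * (R + s) ^ 2) := by
  let g : (EuclideanSpace ℝ (Fin 2)) → (EuclideanSpace ℝ (Fin 2)) → ℝ := fun p => (ball p s).indicator fun _ => (1 : ℝ)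
  let h : (EuclideanSpace ℝ (Fin 2)) → ℝ := (ball y (R + s)).indicator fun _ => (1 : ℝ)
  let G : (EuclideanSpace ℝ (Fin 2)) × (EuclideanSpace ℝ (Fin 2)) → (EuclideanSpace ℝ (Fin 2)) → ℝ := fun q => (ball q.1 s ∩ ball q.2 s).indicator fun _ => (1 : ℝ)
  have hint1 : ∀ (A : Set (EuclideanSpace ℝ (Fin 2))), MeasurableSet A → volume A < ⊤ →
      Integrable (A.indicator fun _ => (1 : ℝ)) := fun A hA hf =>
    (integrable_indicator_iff hA).2 (integrableOn_const hf.ne)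
  have hval : ∀ (A : Set (EuclideanSpace ℝ (Fin 2))), MeasurableSet A →
      ∫ x, (A.indicator (fun _ => (1 : ℝ))) x = volume.real A := fun A hA => by
    rw [integral_indicator_const _ hA]; simp
  have hg : ∀ p, Integrable (g p) := fun p => hint1 _ measurableSet_ball measure_ball_lt_top
  have hh : Integrable h := hint1 _ measurableSet_ball measure_ball_lt_top
  have hG : ∀ q, Integrable (G q) := fun q =>
    hint1 _ (measurableSet_ball.inter measurableSet_ball)
      ((measure_mono Set.inter_subset_left).trans_lt measure_ball_lt_top)
  have hpt : ∀ x, 4 * ∑ p ∈ F, g p x ≤ ∑ q ∈ F ×ˢ F, G q x + 4 * h x := by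
    intro x
    have e1 : ∑ q ∈ F ×ˢ F, G q x = (∑ p ∈ F, g p x) * (∑ p ∈ F, g p x) := by
      rw [Finset.sum_product, Finset.sum_mul_sum]
      refine Finset.sum_congr rfl fun p _ => Finset.sum_congr rfl fun q _ => ?_
      simp only [G, g, Set.indicator_apply, Set.mem_inter_iff]
      split_ifs <;> simp_all
    rw [e1]
    by_cases hx : x ∈ ball y (R + s)
    · have : h x = 1 := by simp only [h, Set.indicator_of_mem hx]
      rw [this]
      nlinarith [sq_nonneg (∑ p ∈ F, g p x - 2)]
    · have h0 : h x = 0 := by simp only [h, Set.indicator_of_notMem hx]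
      have hz : ∑ p ∈ F, g p x = 0 := by
        refine Finset.sum_eq_zero fun p hp => ?_
        refine Set.indicator_of_notMem (fun hxp => hx ?_) _
        have := hB p hp
        rw [mem_ball] at *
        linarith [dist_triangle x p y]
      rw [h0, hz]; simp
  have hI := integral_mono (μ := volume)
    ((integrable_finsetSum F fun p _ => hg p).const_mul 4)
    ((integrable_finsetSum (F ×ˢ F) fun q _ => hG q).add (hh.const_mul 4)) hpt
  have hGle : ∀ q ∈ F ×ˢ F, ∫ x, G q x ≤
      if dist q.1 q.2 < 2 * s then Real.pi * s ^ 2 else 0 := by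
    intro q _
    simp only [G]
    rw [hval _ (measurableSet_ball.inter measurableSet_ball)]
    split_ifs with hd
    · rw [← ball_vol q.1 hs]
      exact measureReal_mono Set.inter_subset_left measure_ball_lt_top.ne
    · have : ball q.1 s ∩ ball q.2 s = ∅ := by
        rw [← Set.disjoint_iff_inter_eq_empty]
        exact ball_disjoint_ball (by linarith)
      rw [this]; simp
  have hL : ∫ x, 4 * ∑ p ∈ F, g p x = 4 * ((F.card : ℝ) * (Real.pi * s ^ 2)) := by
    rw [integral_const_mul, integral_finsetSum F fun p _ => hg p]
    congr 1
    rw [← nsmul_eq_mul]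
    refine Finset.sum_eq_card_nsmul fun p _ => ?_
    simp only [g]
    rw [hval _ measurableSet_ball, ball_vol p hs]
  have hRt : ∫ x, (∑ q ∈ F ×ˢ F, G q x + 4 * h x) =
      ∑ q ∈ F ×ˢ F, (∫ x, G q x) + 4 * (Real.pi * (R + s) ^ 2) := by
    rw [integral_add (integrable_finsetSum (F ×ˢ F) fun q _ => hG q) (hh.const_mul 4),
      integral_const_mul, integral_finsetSum (F ×ˢ F) fun q _ => hG q]
    simp only [h]
    rw [hval _ measurableSet_ball, ball_vol y (by linarith)]
  have hS := Finset.sum_le_sum hGle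
  rw [← Finset.sum_filter, Finset.sum_const, nsmul_eq_mul] at hS
  have hI' : 4 * ((F.card : ℝ) * (Real.pi * s ^ 2)) ≤
      ∑ q ∈ F ×ˢ F, (∫ x, G q x) + 4 * (Real.pi * (R + s) ^ 2) := by
    rw [← hL, ← hRt]; exact hI
  linarith

open Classical in
lemma key_ineq (Γ : Set (EuclideanSpace ℝ (Fin 2))) (hΓ : ∀ p ∈ Γ, IsIntPt p) (U : Finset (EuclideanSpace ℝ (Fin 2))) {s R : ℝ} (hs : 0 < s)
    (hU : ∀ u, IsIntPt u → u ∈ ball (0 : (EuclideanSpace ℝ (Fin 2))) (2 * s) → u ∈ U) (hR : 1 ≤ R) :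
    4 * densR Γ R * (Real.pi * s ^ 2) ≤
      (∑ u ∈ U, densR {x ∈ Γ | x + u ∈ Γ} R) * (Real.pi * s ^ 2) + 4 * (1 + s / R) ^ 2 := by
  have hR0 : 0 < R := by linarith
  have hpi := Real.pi_pos
  have main : densR Γ R ≤ ((∑ u ∈ U, densR {x ∈ Γ | x + u ∈ Γ} R) * (Real.pi * s ^ 2)
      + 4 * (1 + s / R) ^ 2) / (4 * (Real.pi * s ^ 2)) := by
    refine ciSup_le fun y => ?_
    have hv := ball_vol y hR0.le
    rw [Measure.real] at hv
    rw [hv, Set.ncard_eq_toFinset_card _ (int_finite Γ hΓ y R)]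
    set F := (int_finite Γ hΓ y R).toFinset with hFdef
    have hF : ∀ p, p ∈ F ↔ p ∈ Γ ∧ p ∈ ball y R := fun p => by simp [hFdef]
    have h2 := second_moment F y hR0.le hs.le (fun p hp => ((hF p).1 hp).2)
    have hP : (((F ×ˢ F).filter fun q => dist q.1 q.2 < 2 * s).card : ℝ) ≤
        (∑ u ∈ U, densR {x ∈ Γ | x + u ∈ Γ} R) * (Real.pi * R ^ 2) := by
      rw [Finset.card_eq_sum_card_fiberwise (f := fun q : (EuclideanSpace ℝ (Fin 2)) × (EuclideanSpace ℝ (Fin 2)) => q.2 - q.1) (t := U)]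
      · push_cast
        rw [Finset.sum_mul]
        refine Finset.sum_le_sum fun u _ => ?_
        have hSu : ∀ p ∈ {x ∈ Γ | x + u ∈ Γ}, IsIntPt p := fun p hp => hΓ p hp.1
        refine le_trans ?_ (le_densR _ hSu y hR)
        rw [Set.ncard_eq_toFinset_card _ (int_finite _ hSu y R)]
        norm_cast
        refine Finset.card_le_card_of_injOn Prod.fst ?_ ?_
        · rintro ⟨a, b⟩ hq
          simp only [Finset.coe_filter, Finset.mem_filter, Finset.mem_product, Set.mem_ofPred_eq,
            hF] at hq
          obtain ⟨⟨⟨ha, hb⟩, _⟩, hu⟩ := hq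
          have : a + u = b := by rw [← hu]; abel
          simp only [Set.Finite.coe_toFinset]
          exact ⟨⟨ha.1, by rw [this]; exact hb.1⟩, ha.2⟩
        · rintro ⟨a, b⟩ hq ⟨a', b'⟩ hq' haa
          simp only [Finset.coe_filter, Set.mem_ofPred_eq] at hq hq' haa
          have h1 := hq.2
          have h2 := hq'.2
          subst haa
          have : b = b' := by rw [← h2] at h1; exact sub_left_injective h1
          rw [this]
      · rintro ⟨a, b⟩ hq
        simp only [Finset.coe_filter, Finset.mem_product, Set.mem_ofPred_eq, hF] at hq
        obtain ⟨⟨ha, hb⟩, hd⟩ := hq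
        refine hU _ ?_ ?_
        · intro i
          obtain ⟨m, hm⟩ := hΓ a ha.1 i
          obtain ⟨n, hn⟩ := hΓ b hb.1 i
          exact ⟨n - m, by simp [hm, hn]⟩
        · rw [mem_ball_zero_iff, ← dist_eq_norm, dist_comm]
          exact hd
    rw [div_le_div_iff₀ (by positivity) (by positivity)]
    have e : (1 + s / R) ^ 2 * (Real.pi * R ^ 2) = Real.pi * (R + s) ^ 2 := by
      field_simp
    have h3 := mul_le_mul_of_nonneg_right hP (by positivity : 0 ≤ Real.pi * s ^ 2)
    linear_combination h2 + h3 - 4 * e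
  rw [le_div_iff₀ (by positivity)] at main
  linarith

/-- existence of a nonzero short difference with large frequency
in a weakly almost periodic Meyer subset of ℤ². -/
theorem exists_short_frequent_difference (Γ : Set (EuclideanSpace ℝ (Fin 2)))
    (hint : ∀ x ∈ Γ, ∀ i : Fin 2, ∃ m : ℤ, x i = (m : ℝ))
    (hmeyer : Meyer Γ) (hwap : WAP Γ)
    (hdens : 0 < upDens Γ)
    (r : ℝ) (hr3 : 3 ≤ r) (hr : r ^ 2 = 8 / (Real.pi * upDens Γ)) :
    ∃ u₀ : EuclideanSpace ℝ (Fin 2),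
      u₀ ∈ ball (0 : EuclideanSpace ℝ (Fin 2)) r ∧ u₀ ≠ 0 ∧
      (∀ i : Fin 2, ∃ m : ℤ, u₀ i = (m : ℝ)) ∧
      1 / (Real.pi * (r + 1) ^ 2) ≤ freq Γ u₀ ∧
      upDens Γ / 16 ≤ 1 / (Real.pi * (r + 1) ^ 2) := by
  classical
  have hpi := Real.pi_pos
  have hr0 : 0 < r := by linarith
  have hD : upDens Γ * (Real.pi * r ^ 2) = 8 := by
    rw [hr]; field_simp
  have hlast : upDens Γ / 16 ≤ 1 / (Real.pi * (r + 1) ^ 2) := by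
    rw [div_le_div_iff₀ (by norm_num) (by positivity)]
    have : (r + 1) ^ 2 ≤ 2 * r ^ 2 := by nlinarith
    have h2 := mul_le_mul_of_nonneg_left this (by positivity : 0 ≤ upDens Γ * Real.pi)
    linarith
  by_contra hcon
  set D := upDens Γ with hDdef
  set c := 1 / (Real.pi * (r + 1) ^ 2) with hc
  have hc0 : 0 < c := by positivity
  have hsmall : ∀ u : (EuclideanSpace ℝ (Fin 2)), IsIntPt u → u ∈ ball (0 : (EuclideanSpace ℝ (Fin 2))) r → u ≠ 0 →
      upDens {x ∈ Γ | x + u ∈ Γ} < c * D := by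
    intro u hu hur hu0
    by_contra hlt
    refine hcon ⟨u, hur, hu0, hu, ?_, hlast⟩
    rw [freq, le_div_iff₀ hdens]
    exact not_lt.1 hlt
  have hfin := int_finite {x | IsIntPt x} (fun p hp => hp) 0 r
  set U := hfin.toFinset with hUdef
  have hU : ∀ u, u ∈ U ↔ IsIntPt u ∧ u ∈ ball (0 : (EuclideanSpace ℝ (Fin 2))) r := fun u => by simp [hUdef]
  have h0 : (0 : (EuclideanSpace ℝ (Fin 2))) ∈ U := (hU 0).2 ⟨fun i => ⟨0, by simp⟩, mem_ball_self hr0⟩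
  have hcard := card_int_le U 0 hr0.le (fun p hp => ((hU p).1 hp).1) (fun p hp => ((hU p).1 hp).2)
  set K : ℝ := ((U.erase 0).card : ℝ) with hK
  have hKU : K + 1 = U.card := by
    rw [hK]; exact_mod_cast Finset.card_erase_add_one h0
  have hKc : K * c < 1 := by
    rw [hc, mul_one_div, div_lt_one (by positivity)]; linarith
  -- eventual bounds
  have hev : ∀ᶠ R in atTop, ∀ u ∈ U.erase 0, densR {x ∈ Γ | x + u ∈ Γ} R < c * D := by
    rw [eventually_all_finset]
    intro u hu
    rw [Finset.mem_erase, hU] at hu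
    exact eventually_lt_of_limsup_lt (hsmall u hu.2.1 hu.2.2 hu.1)
      (densR_bdd _ fun p hp => hint p hp.1)
  set δ := (1 - K * c) / 8 with hδ
  have hδ0 : 0 < δ := by rw [hδ]; linarith
  have hfr : ∃ᶠ R in atTop, D * (1 - δ) < densR Γ R :=
    frequently_lt_of_lt_limsup (densR_cobdd Γ) (by
      change D * (1 - δ) < D
      nlinarith)
  have hlim : Tendsto (fun R : ℝ => (1 + (r / 2) / R) ^ 2) atTop (nhds 1) := by
    have : Tendsto (fun R : ℝ => (r / 2) / R) atTop (nhds 0) := tendsto_const_nhds.div_atTop tendsto_id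
    simpa using (this.const_add 1).pow 2
  have hev2 := hlim.eventually_lt_const (by linarith : (1 : ℝ) < 1 + δ)
  obtain ⟨R, hR1, hRu, hR2, hR3⟩ :=
    (hfr.and_eventually (hev.and (hev2.and (eventually_ge_atTop 1)))).exists
  have key := key_ineq Γ hint U (half_pos hr0)
    (fun u hu hub => (hU u).2 ⟨hu, by rwa [mul_div_cancel₀ r two_ne_zero] at hub⟩) hR3
  have hz : {x ∈ Γ | x + (0 : (EuclideanSpace ℝ (Fin 2))) ∈ Γ} = Γ := by ext x; simp
  rw [← Finset.add_sum_erase U _ h0, hz] at key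
  have hsum : ∑ u ∈ U.erase 0, densR {x ∈ Γ | x + u ∈ Γ} R ≤ K * (c * D) := by
    rw [hK, ← nsmul_eq_mul]
    exact Finset.sum_le_card_nsmul _ _ _ fun u hu => (hRu u hu).le
  set A := Real.pi * (r / 2) ^ 2 with hA
  have hA0 : 0 < A := by positivity
  have hDA : D * A = 2 := by rw [hA]; linarith
  have k1 := mul_le_mul_of_nonneg_right hsum hA0.le
  have k2 := mul_lt_mul_of_pos_right hR1 hA0
  have k3 : K * (c * D) * A = 2 * (K * c) := by linear_combination (K * c) * hDA
  have k4 : D * (1 - δ) * A = 2 * (1 - δ) := by linear_combination (1 - δ) * hDA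
  have k5 : K * c = 1 - 8 * δ := by rw [hδ]; ring
  nlinarith
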